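/- arXiv:2005.03109 — 6 statements merged into one kernel-verified Lean document; each statement's English description precedes it below -/
import Mathlib

section
/- Let C₁ and C₂ be canonical finite metric spaces (of cardinalities n₁ and n₂ respectively). Then C₁ is weakly isometric to C₂ if and only if C₁ is isometric to C₂ (i.e., there is a distance-preserving bijection between them). -/
open scoped NNReal

def WeaklyIsometric (X Y : Type*) [MetricSpace X] [MetricSpace Y] : Prop :=
  ∃ (φ : X ≃ Y) (ψ : ℝ≥0 → ℝ≥0), StrictMono ψ ∧
    ∀ x₁ x₂ : X, ψ (nndist x₁ x₂) = nndist (φ x₁) (φ x₂)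

def distSet (X : Type*) [MetricSpace X] : Set ℝ :=
  {r | ∃ x₁ x₂ : X, x₁ ≠ x₂ ∧ dist x₁ x₂ = r}

def IsCanonical (X : Type*) [MetricSpace X] [Fintype X] : Prop :=
  distSet X = Nat.cast ''
    Set.Icc (2 * Nat.choose (Fintype.card X) 2 - (distSet X).ncard + 1)
            (2 * Nat.choose (Fintype.card X) 2)

/-- A strictly increasing map sending a finite set of a linear order into itself fixes that set
pointwise. -/
theorem StrictMono.eqOn_id_of_mapsTo {α : Type*} [LinearOrder α] {f : α → α} (hf : StrictMono f)
    {s : Set α} (hs : s.Finite) (hfs : Set.MapsTo f s s) : Set.EqOn f id s := by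
  intro x hx
  have : Finite s := hs
  have hg : StrictMono (hfs.restrict f s s) := fun a b hab => hf hab
  exact le_antisymm (hg.apply_le (x := ⟨x, hx⟩)) (hg.le_apply (x := ⟨x, hx⟩))

theorem distSet_eq_image_nndist (X : Type*) [MetricSpace X] :
    distSet X = NNReal.toReal '' {r | ∃ x₁ x₂ : X, x₁ ≠ x₂ ∧ nndist x₁ x₂ = r} := by
  ext r
  constructor
  · rintro ⟨x, y, hxy, rfl⟩
    exact ⟨nndist x y, ⟨x, y, hxy, rfl⟩, rfl⟩
  · rintro ⟨_, ⟨x, y, hxy, rfl⟩, rfl⟩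
    exact ⟨x, y, hxy, rfl⟩

/-- Canonical finite metric spaces are weakly isometric iff they are isometric. -/
theorem canonical_weaklyIsometric_iff_isometric (C₁ C₂ : Type*)
    [MetricSpace C₁] [MetricSpace C₂] [Fintype C₁] [Fintype C₂]
    (h₁ : IsCanonical C₁) (h₂ : IsCanonical C₂) :
    WeaklyIsometric C₁ C₂ ↔ Nonempty (C₁ ≃ᵢ C₂) := by
  constructor
  · rintro ⟨φ, ψ, hψ, h⟩
    set S₁ : Set ℝ≥0 := {r | ∃ x₁ x₂ : C₁, x₁ ≠ x₂ ∧ nndist x₁ x₂ = r}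
    set S₂ : Set ℝ≥0 := {r | ∃ x₁ x₂ : C₂, x₁ ≠ x₂ ∧ nndist x₁ x₂ = r}
    have hD₁ : distSet C₁ = NNReal.toReal '' S₁ := distSet_eq_image_nndist C₁
    have hD₂ : distSet C₂ = NNReal.toReal '' S₂ := distSet_eq_image_nndist C₂
    have himage : ψ '' S₁ = S₂ := by
      ext r
      constructor
      · rintro ⟨_, ⟨x, y, hxy, rfl⟩, rfl⟩
        exact ⟨φ x, φ y, φ.injective.ne hxy, (h x y).symm⟩
      · rintro ⟨x, y, hxy, rfl⟩
        exact ⟨_, ⟨φ.symm x, φ.symm y, φ.symm.injective.ne hxy, rfl⟩, by simp [h]⟩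
    have hncard : (distSet C₁).ncard = (distSet C₂).ncard := by
      rw [hD₁, hD₂, Set.ncard_image_of_injective _ NNReal.coe_injective,
        Set.ncard_image_of_injective _ NNReal.coe_injective, ← himage,
        Set.ncard_image_of_injective _ hψ.injective]
    have hD : distSet C₁ = distSet C₂ := by
      unfold IsCanonical at h₁ h₂
      rw [h₁, h₂, hncard, Fintype.card_congr φ]
    have hS : S₁ = S₂ := NNReal.coe_injective.image_injective (hD₁ ▸ hD₂ ▸ hD)
    have hfin : S₁.Finite := by
      refine (Set.finite_range fun p : C₁ × C₁ => nndist p.1 p.2).subset ?_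
      rintro _ ⟨x, y, -, rfl⟩
      exact ⟨(x, y), rfl⟩
    have hfix := hψ.eqOn_id_of_mapsTo hfin fun r hr => hS ▸ himage ▸ Set.mem_image_of_mem ψ hr
    refine ⟨⟨φ, isometry_iff_nndist_eq.2 fun x y => ?_⟩⟩
    rcases eq_or_ne x y with rfl | hxy
    · simp
    · exact (h x y).symm.trans (hfix ⟨x, y, hxy, rfl⟩)
  · rintro ⟨e⟩
    exact ⟨e.toEquiv, id, strictMono_id, fun x y => (e.isometry.nndist_eq x y).symm⟩
end

section
/- Uniqueness of canonical representatives: if C and C' are both canonical finite metric spaces that are each weakly isometric to the same finite metric space X, then C and C' are isometric. In other words, the canonical metric space weakly isometric to a given finite metric space is unique up to isometry. -/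
open scoped NNReal

/-- The set of nonzero distances, valued in the nonnegative reals. -/
def nndistSet (X : Type*) [MetricSpace X] : Set ℝ≥0 :=
  {r | ∃ x₁ x₂ : X, x₁ ≠ x₂ ∧ nndist x₁ x₂ = r}

theorem distSet_eq_image_nndistSet (X : Type*) [MetricSpace X] :
    distSet X = NNReal.toReal '' nndistSet X := by
  ext r
  constructor
  · rintro ⟨x, y, h, rfl⟩
    exact ⟨nndist x y, ⟨x, y, h, rfl⟩, coe_nndist x y⟩
  · rintro ⟨_, ⟨x, y, h, rfl⟩, rfl⟩
    exact ⟨x, y, h, (coe_nndist x y).symm⟩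

theorem ncard_distSet (X : Type*) [MetricSpace X] :
    (distSet X).ncard = (nndistSet X).ncard := by
  rw [distSet_eq_image_nndistSet, Set.ncard_image_of_injective _ NNReal.coe_injective]

theorem nndistSet_eq_image {X Y : Type*} [MetricSpace X] [MetricSpace Y] (φ : X ≃ Y)
    {ψ : ℝ≥0 → ℝ≥0} (h : ∀ x₁ x₂ : X, ψ (nndist x₁ x₂) = nndist (φ x₁) (φ x₂)) :
    nndistSet Y = ψ '' nndistSet X := by
  ext r
  constructor
  · rintro ⟨x, y, hxy, rfl⟩
    exact ⟨_, ⟨φ.symm x, φ.symm y, φ.symm.injective.ne hxy, rfl⟩, by simp [h]⟩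
  · rintro ⟨_, ⟨x, y, hxy, rfl⟩, rfl⟩
    exact ⟨φ x, φ y, φ.injective.ne hxy, (h x y).symm⟩

theorem finite_nndistSet (X : Type*) [MetricSpace X] [Finite X] : (nndistSet X).Finite := by
  refine (Set.finite_range fun p : X × X => nndist p.1 p.2).subset ?_
  rintro _ ⟨x, y, -, rfl⟩
  exact ⟨(x, y), rfl⟩

/-- Two strictly monotone functions with the same image of a finite set agree on that set. -/
theorem StrictMono.eqOn_of_image_eq_of_finite {α β : Type*} [LinearOrder α] [PartialOrder β]
    {f g : α → β} (hf : StrictMono f) (hg : StrictMono g) {s : Set α} (hs : s.Finite)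
    (h : f '' s = g '' s) : Set.EqOn f g s := by
  have := hs.to_subtype
  rw [Set.image_eq_range, Set.image_eq_range] at h
  have hfg := (StrictMono.range_inj (f := fun x : s => f x) (g := fun x : s => g x)
    (fun _ _ hxy => hf hxy) (fun _ _ hxy => hg hxy)).1 h
  exact fun x hx => congrFun hfg ⟨x, hx⟩

/-- Uniqueness of canonical representatives: two canonical finite metric spaces that are
weakly isometric to the same finite metric space are isometric. -/
theorem canonical_representative_unique (X C C' : Type*)
    [MetricSpace X] [MetricSpace C] [MetricSpace C']
    [Fintype X] [Fintype C] [Fintype C']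
    (hC : IsCanonical C) (hC' : IsCanonical C')
    (h1 : WeaklyIsometric C X) (h2 : WeaklyIsometric C' X) :
    Nonempty (C ≃ᵢ C') := by
  obtain ⟨φ, ψ, hψ, h⟩ := h1
  obtain ⟨φ', ψ', hψ', h'⟩ := h2
  have hcard : Fintype.card C = Fintype.card C' := Fintype.card_congr (φ.trans φ'.symm)
  have hX := nndistSet_eq_image φ h
  have hX' := nndistSet_eq_image φ' h'
  have hncard : (distSet C).ncard = (distSet C').ncard := by
    rw [ncard_distSet, ncard_distSet, ← Set.ncard_image_of_injective _ hψ.injective, ← hX, hX',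
      Set.ncard_image_of_injective _ hψ'.injective]
  have hdist : nndistSet C = nndistSet C' := by
    apply NNReal.coe_injective.image_injective
    rw [← distSet_eq_image_nndistSet, ← distSet_eq_image_nndistSet, hC, hC', hcard, hncard]
  have heq : Set.EqOn ψ ψ' (nndistSet C') :=
    hψ.eqOn_of_image_eq_of_finite hψ' (finite_nndistSet C') (by rw [← hX', hX, hdist])
  refine ⟨IsometryEquiv.mk (φ.trans φ'.symm) (isometry_iff_nndist_eq.2 fun x y => ?_)⟩
  rcases eq_or_ne x y with rfl | hxy
  · simp
  · apply hψ.injective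
    rw [Equiv.toFun_as_coe, heq ⟨_, _, (φ.trans φ'.symm).injective.ne hxy, rfl⟩, h, h']
    simp
end

section
/- Two finite metric spaces X and Y are weakly isometric if and only if their canonicalizations C_X and C_Y are isometric. More generally, if C_X is a canonical finite metric space weakly isometric to X and C_Y is a canonical finite metric space weakly isometric to Y, then X is weakly isometric to Y if and only if C_X is isometric to C_Y. -/
open scoped NNReal

open Finset Filter Topology in
/-- A strictly increasing correspondence between finite families of nonnegative reals that matches
`0` with `0` extends to a strictly increasing function on `ℝ≥0`. -/
theorem exists_strictMono_nnreal_extension {ι : Type*} [Finite ι] (a b : ι → ℝ≥0)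
    (hab : ∀ i j, a i < a j ↔ b i < b j) (i₀ : ι) (ha : a i₀ = 0) :
    ∃ ψ : ℝ≥0 → ℝ≥0, StrictMono ψ ∧ ∀ i, ψ (a i) = b i := by
  classical
  have := Fintype.ofFinite ι
  obtain ⟨ε, hε, hpos⟩ : ∃ ε : ℝ≥0, (∀ i j, a i < a j → b i + ε * (a j - a i) < b j) ∧ 0 < ε := by
    have hev : ∀ᶠ ε : ℝ≥0 in 𝓝[>] 0, ∀ i j, a i < a j → b i + ε * (a j - a i) < b j := by
      refine eventually_all.2 fun i ↦ eventually_all.2 fun j ↦ ?_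
      by_cases h : a i < a j
      · have hc : Continuous fun ε : ℝ≥0 ↦ b i + ε * (a j - a i) := by fun_prop
        have h0 : b i + 0 * (a j - a i) < b j := by simpa using (hab i j).1 h
        filter_upwards [nhdsWithin_le_nhds ((hc.tendsto 0).eventually_lt_const h0)] with ε hε _
        exact hε
      · simp [h]
    exact (hev.and self_mem_nhdsWithin).exists
  refine ⟨fun t ↦ (univ.filter fun i ↦ a i ≤ t).sup fun i ↦ b i + ε * (t - a i), ?_, ?_⟩
  · intro s t hst
    obtain ⟨i, hi, hsup⟩ := exists_mem_eq_sup (univ.filter fun i ↦ a i ≤ s)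
      ⟨i₀, by simp [ha]⟩ fun i ↦ b i + ε * (s - a i)
    have his : a i ≤ s := by simpa using hi
    simp only [hsup]
    calc b i + ε * (s - a i) < b i + ε * (t - a i) := by
          gcongr
          exact tsub_lt_tsub_right_of_le his hst
      _ ≤ _ := le_sup (f := fun i ↦ b i + ε * (t - a i)) (by simpa using his.trans hst.le)
  · intro j
    refine le_antisymm (Finset.sup_le fun i hi ↦ ?_) ?_
    · have hij : a i ≤ a j := by simpa using hi
      rcases hij.lt_or_eq with h | h
      · exact (hε i j h).le
      · have : b i ≤ b j := not_lt.1 fun h' ↦ ((hab j i).2 h').ne' h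
        simpa [h] using this
    · simpa using le_sup (s := univ.filter fun i ↦ a i ≤ a j)
        (f := fun i ↦ b i + ε * (a j - a i)) (b := j) (by simp)

/-- A bijection of finite metric spaces is a weak isometry as soon as it preserves and reflects the
order between distances. -/
theorem weaklyIsometric_iff_exists_dist_lt_iff (X Y : Type*) [MetricSpace X] [MetricSpace Y]
    [Finite X] :
    WeaklyIsometric X Y ↔ ∃ φ : X ≃ Y, ∀ x₁ x₂ x₃ x₄,
      dist x₁ x₂ < dist x₃ x₄ ↔ dist (φ x₁) (φ x₂) < dist (φ x₃) (φ x₄) := by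
  constructor
  · rintro ⟨φ, ψ, hψ, h⟩
    refine ⟨φ, fun x₁ x₂ x₃ x₄ ↦ ?_⟩
    simp only [dist_nndist, NNReal.coe_lt_coe, ← h, hψ.lt_iff_lt]
  · rintro ⟨φ, h⟩
    rcases isEmpty_or_nonempty X with hX | ⟨⟨x⟩⟩
    · exact ⟨φ, id, strictMono_id, fun x ↦ hX.elim x⟩
    · obtain ⟨ψ, hψ, hd⟩ := exists_strictMono_nnreal_extension
        (fun p : X × X ↦ nndist p.1 p.2) (fun p ↦ nndist (φ p.1) (φ p.2))
        (fun p q ↦ h p.1 p.2 q.1 q.2) (x, x) (nndist_self x)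
      exact ⟨φ, ψ, hψ, fun x₁ x₂ ↦ hd (x₁, x₂)⟩

theorem WeaklyIsometric.symm {X Y : Type*} [MetricSpace X] [MetricSpace Y] [Finite X]
    (h : WeaklyIsometric X Y) : WeaklyIsometric Y X := by
  obtain ⟨φ, hφ⟩ := (weaklyIsometric_iff_exists_dist_lt_iff X Y).1 h
  have : Finite Y := .of_equiv X φ
  exact (weaklyIsometric_iff_exists_dist_lt_iff Y X).2
    ⟨φ.symm, fun y₁ y₂ y₃ y₄ ↦ by simp [hφ]⟩

theorem WeaklyIsometric.trans {X Y Z : Type*} [MetricSpace X] [MetricSpace Y] [MetricSpace Z]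
    (h₁ : WeaklyIsometric X Y) (h₂ : WeaklyIsometric Y Z) : WeaklyIsometric X Z := by
  obtain ⟨φ₁, ψ₁, hψ₁, hd₁⟩ := h₁
  obtain ⟨φ₂, ψ₂, hψ₂, hd₂⟩ := h₂
  exact ⟨φ₁.trans φ₂, ψ₂ ∘ ψ₁, hψ₂.comp hψ₁, fun x₁ x₂ ↦ by simp [hd₁, hd₂]⟩

theorem IsometryEquiv.weaklyIsometric {X Y : Type*} [MetricSpace X] [MetricSpace Y]
    (e : X ≃ᵢ Y) : WeaklyIsometric X Y :=
  ⟨e.toEquiv, id, strictMono_id, fun x₁ x₂ ↦ (e.isometry.nndist_eq x₁ x₂).symm⟩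

theorem finite_distSet (X : Type*) [MetricSpace X] [Finite X] : (distSet X).Finite := by
  refine (Set.finite_range fun p : X × X ↦ dist p.1 p.2).subset ?_
  rintro _ ⟨x₁, x₂, -, rfl⟩
  exact ⟨(x₁, x₂), rfl⟩

/-- Weakly isometric canonical spaces are isometric. -/
theorem IsCanonical.nonempty_isometryEquiv {X Y : Type*} [MetricSpace X] [MetricSpace Y]
    [Fintype X] [Fintype Y] (hX : IsCanonical X) (hY : IsCanonical Y)
    (h : WeaklyIsometric X Y) : Nonempty (X ≃ᵢ Y) := by
  obtain ⟨φ, ψ, hψ, hd⟩ := h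
  let g : distSet X → ℝ := fun r ↦ ψ (r : ℝ).toNNReal
  have hg : ∀ x₁ x₂ (hx : dist x₁ x₂ ∈ distSet X), g ⟨_, hx⟩ = dist (φ x₁) (φ x₂) := by
    intro x₁ x₂ hx
    simp only [g, dist_nndist, Real.toNNReal_coe, hd]
  have hmono : StrictMono g := by
    intro r s hrs
    have hr : 0 ≤ (r : ℝ) := by
      obtain ⟨_, x₁, x₂, -, rfl⟩ := r
      exact dist_nonneg
    refine NNReal.coe_lt_coe.2 (hψ ?_)
    exact (Real.toNNReal_lt_toNNReal_iff_of_nonneg hr).2 hrs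
  have hrange : Set.range g = distSet Y := by
    ext r
    constructor
    · rintro ⟨⟨_, x₁, x₂, hne, rfl⟩, rfl⟩
      exact ⟨φ x₁, φ x₂, φ.injective.ne hne, (hg x₁ x₂ _).symm⟩
    · rintro ⟨y₁, y₂, hne, rfl⟩
      refine ⟨⟨_, φ.symm y₁, φ.symm y₂, φ.symm.injective.ne hne, rfl⟩, ?_⟩
      simpa using hg (φ.symm y₁) (φ.symm y₂) ⟨_, _, φ.symm.injective.ne hne, rfl⟩
  have hcard : (distSet X).ncard = (distSet Y).ncard := by
    rw [← hrange, ← Nat.card_coe_set_eq, ← Nat.card_coe_set_eq,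
      Nat.card_range_of_injective hmono.injective]
  have heq : distSet X = distSet Y := by
    rw [hX, hY, hcard, Fintype.card_congr φ]
  have : Finite (distSet X) := finite_distSet X
  have hval : g = Subtype.val :=
    (StrictMono.range_inj hmono (Subtype.strictMono_coe _)).1 (by simp [hrange, heq])
  refine ⟨⟨φ, Isometry.of_dist_eq fun x₁ x₂ ↦ ?_⟩⟩
  rcases eq_or_ne x₁ x₂ with rfl | hne
  · simp
  · exact (hg x₁ x₂ ⟨x₁, x₂, hne, rfl⟩).symm.trans (congrFun hval _)

/-- Two finite metric spaces are weakly isometric iff their canonicalizations are isometric. -/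
theorem weaklyIsometric_iff_canonicalizations_isometric
    (X Y CX CY : Type*) [MetricSpace X] [MetricSpace Y] [MetricSpace CX] [MetricSpace CY]
    [Fintype X] [Fintype Y] [Fintype CX] [Fintype CY]
    (hCX : IsCanonical CX) (hCY : IsCanonical CY)
    (h1 : WeaklyIsometric CX X) (h2 : WeaklyIsometric CY Y) :
    WeaklyIsometric X Y ↔ Nonempty (CX ≃ᵢ CY) := by
  constructor
  · exact fun h ↦ hCX.nonempty_isometryEquiv hCY ((h1.trans h).trans h2.symm)
  · rintro ⟨e⟩
    exact (h1.symm.trans e.weaklyIsometric).trans h2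
end

section
/- Let (X,d_X) and (Y,d_Y) be finite metric spaces, both of cardinality n. Then K_m(X) = K_m(Y) for all m ∈ ℕ if and only if K_n(X) = K_n(Y), where K_m denotes the m-th curvature set. -/
/-- The `m`-th curvature set of a metric space: all `m × m` matrices of pairwise distances
of `m`-tuples of (not necessarily distinct) points. -/
def curv (X : Type*) [MetricSpace X] (m : ℕ) : Set (Matrix (Fin m) (Fin m) ℝ) :=
  {M | ∃ x : Fin m → X, ∀ i j, M i j = dist (x i) (x j)}

/-- An isometric embedding of `X` into `Y` induces inclusions of curvature sets. -/
theorem Isometry.curv_subset {X Y : Type*} [MetricSpace X] [MetricSpace Y] {f : X → Y}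
    (hf : Isometry f) (m : ℕ) : curv X m ⊆ curv Y m := by
  rintro M ⟨x, hx⟩
  exact ⟨f ∘ x, fun i j => (hx i j).trans (hf.dist_eq _ _).symm⟩

/-- A finite metric space whose curvature set at its cardinality is contained in that of `Y`
embeds isometrically into `Y`. -/
theorem exists_isometry_of_curv_subset {X Y : Type*} [MetricSpace X] [MetricSpace Y]
    [Fintype X] {n : ℕ} (hX : Fintype.card X = n) (h : curv X n ⊆ curv Y n) :
    ∃ f : X → Y, Isometry f := by
  let e := Fintype.equivFinOfCardEq hX
  obtain ⟨y, hy⟩ := h (show (fun i j => dist (e.symm i) (e.symm j)) ∈ curv X n from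
    ⟨e.symm, fun _ _ => rfl⟩)
  exact ⟨y ∘ e, Isometry.of_dist_eq fun a b => by simpa using (hy (e a) (e b)).symm⟩

/-- For finite metric spaces of cardinality `n`, equality of all curvature sets is
equivalent to equality of the `n`-th curvature sets. -/
theorem curv_all_iff_curv_card (X Y : Type*) [MetricSpace X] [MetricSpace Y]
    [Fintype X] [Fintype Y] (n : ℕ)
    (hX : Fintype.card X = n) (hY : Fintype.card Y = n) :
    (∀ m : ℕ, curv X m = curv Y m) ↔ curv X n = curv Y n := by
  refine ⟨fun h => h n, fun h m => ?_⟩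
  obtain ⟨f, hf⟩ := exists_isometry_of_curv_subset hX h.subset
  obtain ⟨g, hg⟩ := exists_isometry_of_curv_subset hY h.superset
  exact (hf.curv_subset m).antisymm (hg.curv_subset m)
end

section
/- Let (X,d_X) and (Y,d_Y) be finite metric spaces, both of cardinality n. For any m ≤ n, K_m(X) = K_m(Y) if and only if K̃_m(X) = K̃_m(Y), where K_m is the m-th curvature set and K̃_m is the m-th reduced curvature set. -/
/-- The `m`-th reduced curvature set of a metric space: all `m × m` matrices of pairwise
distances of `m`-tuples of pairwise distinct points. -/
def curvRed (X : Type*) [MetricSpace X] (m : ℕ) : Set (Matrix (Fin m) (Fin m) ℝ) :=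
  {M | ∃ x : Fin m → X, Function.Injective x ∧ ∀ i j, M i j = dist (x i) (x j)}

theorem mem_curvRed_iff {X : Type*} [MetricSpace X] {m : ℕ} {M : Matrix (Fin m) (Fin m) ℝ} :
    M ∈ curvRed X m ↔ M ∈ curv X m ∧ ∀ i j, M i j = 0 → i = j := by
  constructor
  · rintro ⟨x, hx, h⟩
    exact ⟨⟨x, h⟩, fun i j hij => hx (dist_eq_zero.mp ((h i j).symm.trans hij))⟩
  · rintro ⟨⟨x, h⟩, h0⟩
    exact ⟨x, fun i j hij => h0 i j ((h i j).trans (dist_eq_zero.mpr hij)), h⟩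

/-- In a finite type with at least `m` elements, every `m`-tuple is obtained by reindexing an
`m`-tuple of pairwise distinct elements. -/
theorem exists_injective_comp_eq {X : Type*} [Fintype X] {m : ℕ} (hm : m ≤ Fintype.card X)
    (x : Fin m → X) : ∃ (z : Fin m → X) (f : Fin m → Fin m), Function.Injective z ∧ z ∘ f = x := by
  classical
  have hcard : (Finset.univ.image x).card ≤ m := by
    simpa using Finset.card_image_le (s := Finset.univ) (f := x)
  obtain ⟨t, hxt, ht⟩ := Finset.exists_superset_card_eq hcard hm
  let e := t.equivFinOfCardEq ht
  refine ⟨fun i => e.symm i, fun i => e ⟨x i, hxt (Finset.mem_image_of_mem x (Finset.mem_univ i))⟩,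
    Subtype.val_injective.comp e.symm.injective, ?_⟩
  funext i
  simp

theorem curv_subset_of_curvRed_subset {X Y : Type*} [MetricSpace X] [MetricSpace Y] [Fintype X]
    {m : ℕ} (hm : m ≤ Fintype.card X) (h : curvRed X m ⊆ curvRed Y m) :
    curv X m ⊆ curv Y m := by
  rintro M ⟨x, hM⟩
  obtain ⟨z, f, hz, rfl⟩ := exists_injective_comp_eq hm x
  obtain ⟨y, -, hy⟩ := @h (fun i j => dist (z i) (z j)) ⟨z, hz, fun _ _ => rfl⟩
  exact ⟨y ∘ f, fun i j => (hM i j).trans (hy (f i) (f j))⟩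

/-- For finite metric spaces of cardinality `n` and `m ≤ n`, the `m`-th curvature sets
agree iff the `m`-th reduced curvature sets agree. -/
theorem curv_eq_iff_curvRed_eq (X Y : Type*) [MetricSpace X] [MetricSpace Y]
    [Fintype X] [Fintype Y] (n m : ℕ)
    (hX : Fintype.card X = n) (hY : Fintype.card Y = n) (hm : m ≤ n) :
    curv X m = curv Y m ↔ curvRed X m = curvRed Y m := by
  constructor
  · intro h
    ext M
    rw [mem_curvRed_iff, mem_curvRed_iff, h]
  · intro h
    exact (curv_subset_of_curvRed_subset (hX ▸ hm) h.subset).antisymm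
      (curv_subset_of_curvRed_subset (hY ▸ hm) h.symm.subset)
end

section
/- Two finite metric spaces (X,d_X) and (Y,d_Y), both of cardinality n, are isometric (there exists a distance-preserving bijection between them) if and only if K̃_n(X) = K̃_n(Y), where K̃_n is the n-th reduced curvature set. -/
theorem curvRed_subset_of_isometry {X Y : Type*} [MetricSpace X] [MetricSpace Y]
    {f : X → Y} (hf : Isometry f) (m : ℕ) : curvRed X m ⊆ curvRed Y m := by
  rintro M ⟨x, hx, hM⟩
  exact ⟨f ∘ x, hf.injective.comp hx, fun i j => by simp [hM, hf.dist_eq]⟩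

/-- Two finite metric spaces of cardinality `n` are isometric iff their `n`-th reduced
curvature sets agree. -/
theorem isometric_iff_curvRed_eq (X Y : Type*) [MetricSpace X] [MetricSpace Y]
    [Fintype X] [Fintype Y] (n : ℕ)
    (hX : Fintype.card X = n) (hY : Fintype.card Y = n) :
    Nonempty (X ≃ᵢ Y) ↔ curvRed X n = curvRed Y n := by
  constructor
  · rintro ⟨e⟩
    exact (curvRed_subset_of_isometry e.isometry n).antisymm
      (curvRed_subset_of_isometry e.symm.isometry n)
  · intro h
    let e : Fin n ≃ X := (Fintype.equivFinOfCardEq hX).symm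
    have hM : (Matrix.of fun i j => dist (e i) (e j)) ∈ curvRed X n :=
      ⟨e, e.injective, fun _ _ => rfl⟩
    rw [h] at hM
    obtain ⟨y, hy, hd⟩ := hM
    have hb : Function.Bijective y :=
      (Fintype.bijective_iff_injective_and_card y).2 ⟨hy, by simp [hY]⟩
    refine ⟨⟨e.symm.trans (Equiv.ofBijective y hb), Isometry.of_dist_eq fun a b => ?_⟩⟩
    simpa using (hd (e.symm a) (e.symm b)).symm
end
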